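/- arXiv:1302.4804 — 2 statements merged into one kernel-verified Lean document; each statement's English description precedes it below -/
import Mathlib

section
/- Let Λ be a net of quadrics in the five variables a,b,c,d,e. Then Λ is ρ-semistable for every integer weight vector ρ=(w_a,w_b,w_c,w_d,w_e) with w_a+w_b+w_c+w_d+w_e=0 if and only if Λ is ρ-semistable for every weight vector ρ obtained by permuting the entries of one of the twelve vectors ρ1,…,ρ12. (The nontrivial direction: semistability with respect to all one-parameter subgroups of the diagonal torus of the twelve listed numerical types implies semistability with respect to every one-parameter subgroup of that torus.) -/
open MvPolynomial

/-- The space of polynomials in the five variables `a,b,c,d,e` (indexed `0,…,4`). -/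
abbrev Quin : Type := MvPolynomial (Fin 5) ℂ

/-- `m` is (the exponent vector of) a quadratic monomial. -/
def QuadMon (m : Fin 5 →₀ ℕ) : Prop := (m.sum fun _ n => n) = 2

/-- A net of quadrics: a 3-dimensional space of quadratic forms. -/
def IsNet (Λ : Submodule ℂ Quin) : Prop :=
  Module.finrank ℂ Λ = 3 ∧ ∀ Q ∈ Λ, MvPolynomial.IsHomogeneous Q 2

/-- The `ρ`-weight of a monomial. -/
def wt (ρ : Fin 5 → ℤ) (m : Fin 5 →₀ ℕ) : ℤ := ∑ i, (m i : ℤ) * ρ i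

/-- `Λ` is semistable with respect to the weight vector `ρ`: there are three distinct
quadratic monomials with total `ρ`-weight `≥ 0` such that the corresponding coefficient
map `Λ → ℂ³` is bijective. -/
def SemistableWrt (Λ : Submodule ℂ Quin) (ρ : Fin 5 → ℤ) : Prop :=
  ∃ m1 m2 m3 : Fin 5 →₀ ℕ, m1 ≠ m2 ∧ m1 ≠ m3 ∧ m2 ≠ m3 ∧
    QuadMon m1 ∧ QuadMon m2 ∧ QuadMon m3 ∧
    0 ≤ wt ρ m1 + wt ρ m2 + wt ρ m3 ∧
    Function.Bijective (fun Q : Λ =>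
      (![MvPolynomial.coeff m1 (Q : Quin), MvPolynomial.coeff m2 (Q : Quin),
         MvPolynomial.coeff m3 (Q : Quin)] : Fin 3 → ℂ))

/-- The twelve distinguished weight vectors `ρ1,…,ρ12`. -/
def rho : Fin 12 → Fin 5 → ℤ :=
  ![![1,1,1,1,-4], ![2,2,2,-3,-3], ![3,3,-2,-2,-2], ![4,-1,-1,-1,-1],
    ![3,3,3,-2,-7], ![4,4,-1,-1,-6], ![9,4,-1,-6,-6], ![7,2,2,-3,-8],
    ![12,7,2,-8,-13], ![9,4,-1,-1,-11], ![14,4,-1,-6,-11], ![13,8,3,-7,-17]]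

/-- A normalized weight vector: nonincreasing, sums to zero and not identically zero. -/
def IsNormalized (ρ : Fin 5 → ℤ) : Prop :=
  (∀ i j : Fin 5, i ≤ j → ρ j ≤ ρ i) ∧ (∑ i, ρ i) = 0 ∧ ρ ≠ 0

/-- Linear substitution of variables by the matrix `g`, as a linear map on polynomials. -/
noncomputable def substMap (g : Matrix (Fin 5) (Fin 5) ℂ) : Quin →ₗ[ℂ] Quin :=
  (MvPolynomial.aeval fun i => ∑ j, MvPolynomial.C (g i j) * MvPolynomial.X j).toLinearMap

/-- Semistability of a net (Hilbert–Mumford criterion for `SL(5)`). -/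
def Semistable (Λ : Submodule ℂ Quin) : Prop :=
  ∀ (g : Matrix.GeneralLinearGroup (Fin 5) ℂ) (ρ : Fin 5 → ℤ), IsNormalized ρ →
    SemistableWrt (Submodule.map (substMap (g : Matrix (Fin 5) (Fin 5) ℂ)) Λ) ρ

/-- The symmetric matrix of a quadratic form. -/
noncomputable def quadMatrix (Q : Quin) : Matrix (Fin 5) (Fin 5) ℂ :=
  Matrix.of fun i j =>
    if i = j then MvPolynomial.coeff (Finsupp.single i 2) Q
    else (1/2) * MvPolynomial.coeff (Finsupp.single i 1 + Finsupp.single j 1) Q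

/-- The discriminant quintic `det (x·A1 + y·A2 + z·A3)` of a net with basis `Q1,Q2,Q3`. -/
noncomputable def netDisc (Q1 Q2 Q3 : Quin) : MvPolynomial (Fin 3) ℂ :=
  Matrix.det (Matrix.of fun i j : Fin 5 =>
    MvPolynomial.C (quadMatrix Q1 i j) * MvPolynomial.X 0 +
    MvPolynomial.C (quadMatrix Q2 i j) * MvPolynomial.X 1 +
    MvPolynomial.C (quadMatrix Q3 i j) * MvPolynomial.X 2)

/-- The net lies on a smooth quartic del Pezzo surface. -/
def OnSmoothDelPezzo (Λ : Submodule ℂ Quin) : Prop :=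
  ∃ P1 P2 : Quin, P1 ∈ Λ ∧ P2 ∈ Λ ∧ LinearIndependent ℂ ![P1, P2] ∧
    ∀ v : Fin 5 → ℂ, v ≠ 0 → MvPolynomial.eval v P1 = 0 → MvPolynomial.eval v P2 = 0 →
      LinearIndependent ℂ
        ![fun i => MvPolynomial.eval v (MvPolynomial.pderiv i P1),
          fun i => MvPolynomial.eval v (MvPolynomial.pderiv i P2)]

namespace NetOfQuadrics

/-- A subdivision scheme for simplicial cones with four generators: `split i j p q` cuts along the
ray `p • (generator i) + q • (generator j)`. -/
inductive ConeTree
  | leaf : ConeTree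
  | split (i j : Fin 4) (p q : ℕ) (l r : ConeTree) : ConeTree

/-- The monomials `x_i x_j` with `i ≤ j`, encoded as pairs of indices. -/
def quadPairs : List (Fin 5 × Fin 5) :=
  [(0,0), (0,1), (0,2), (0,3), (0,4), (1,1), (1,2), (1,3), (1,4), (2,2), (2,3), (2,4), (3,3),
    (3,4), (4,4)]

/-- The weight of the monomial `x_i x_j`. -/
def pairWt (v : Fin 5 → ℕ) (x : Fin 5 × Fin 5) : ℕ := v x.1 + v x.2

/-- The sum of the five entries of a weight vector. -/
def total (v : Fin 5 → ℕ) : ℕ := v 0 + v 1 + v 2 + v 3 + v 4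

/-- `(tops f l).1`, `(tops f l).2.1`, `(tops f l).2.2` are the largest sums of `f` over at most
one, two, three entries of `l`. -/
def tops {ι : Type*} (f : ι → ℕ) : List ι → ℕ × ℕ × ℕ
  | [] => (0, 0, 0)
  | x :: l => (max (tops f l).1 (f x), max (tops f l).2.1 (f x + (tops f l).1),
      max (tops f l).2.2 (f x + (tops f l).2.1))

/-- An upper bound for `f x + f y + f z` when `x ∈ l₁`, `y ∈ l₂`, `z ∈ l₃` are distinct and
`l₃ ⊆ l₂ ⊆ l₁`. -/
def tripleBound {ι : Type*} (f : ι → ℕ) (l₁ l₂ l₃ : List ι) : ℕ :=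
  min (min ((tops f l₁).1 + (tops f l₂).1 + (tops f l₃).1) ((tops f l₂).2.1 + (tops f l₁).1))
    (min ((tops f l₁).2.1 + (tops f l₃).1) (tops f l₁).2.2)

/-- The distinguished weight vectors, shifted to have nonnegative entries. -/
def shiftedRho (k : Fin 12) (i : Fin 5) : ℕ := (rho k i - rho k 4).toNat

/-- Some distinguished weight vector is negative on all admissible triples. -/
def excluded (l₁ l₂ l₃ : List (Fin 5 × Fin 5)) : Bool :=
  (List.finRange 12).any fun k =>
    Nat.blt (5 * tripleBound (pairWt (shiftedRho k)) l₁ l₂ l₃) (6 * total (shiftedRho k))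

/-- All generators of the cone have nonnegative normalized weight on the triple `x, y, z`. -/
def nonnegOn (C : Fin 4 → Fin 5 → ℕ) (x y z : Fin 5 × Fin 5) : Bool :=
  (List.finRange 4).all fun k =>
    Nat.ble (6 * total (C k)) (5 * (pairWt (C k) x + pairWt (C k) y + pairWt (C k) z))

/-- `f` holds at every nonempty tail of the list. -/
def allTails {ι : Type*} (f : ι → List ι → Bool) : List ι → Bool
  | [] => true
  | x :: l => f x l && allTails f l

/-- The criterion verified on a cone `C` with respect to the ordering `o` of monomials. -/
def leafCheck (C : Fin 4 → Fin 5 → ℕ) (o : List (Fin 5 × Fin 5)) : Bool :=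
  allTails (fun x s => allTails (fun y t => allTails (fun z r =>
    nonnegOn C x y z || excluded (x :: s) (y :: t) (z :: r)) t) s) o

/-- The monomials ordered by their weight at the barycentre of the cone. -/
def coneOrder (C : Fin 4 → Fin 5 → ℕ) : List (Fin 5 × Fin 5) :=
  quadPairs.insertionSort fun x y =>
    pairWt (fun i => C 0 i + C 1 i + C 2 i + C 3 i) y ≤
      pairWt (fun i => C 0 i + C 1 i + C 2 i + C 3 i) x

/-- The criterion verified on all cells of a subdivision. -/
def treeCheck : ConeTree → (Fin 4 → Fin 5 → ℕ) → Bool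
  | .leaf, C => leafCheck C (coneOrder C)
  | .split i j p q l r, C =>
    (decide (i ≠ j) && Nat.blt 0 p && Nat.blt 0 q) &&
      (treeCheck l (Function.update C i (fun t => p * C i t + q * C j t)) &&
        treeCheck r (Function.update C j (fun t => p * C i t + q * C j t)))

/-- The generators of the cone of nonincreasing weight vectors with last entry zero. -/
def chamber : Fin 4 → Fin 5 → ℕ :=
  ![![1,1,1,1,0], ![1,1,1,0,0], ![1,1,0,0,0], ![1,0,0,0,0]]

/-- A subdivision of the chamber on each cell of which `leafCheck` succeeds. -/
def chamberTree : ConeTree :=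
  .split 3 1 1 1 (.split 2 1 1 1 (.split 2 0 1 1 (.split 3 0 1 1 .leaf (.split 3 2 1 1 .leaf
    .leaf)) .leaf) (.split 3 2 1 1 (.split 3 0 1 1 (.split 2 0 1 1 (.split 1 0 1 2 .leaf .leaf)
    (.split 1 0 1 1 .leaf .leaf)) .leaf) (.split 2 0 1 1 (.split 1 0 1 1 (.split 3 0 1 1 (.split
    2 0 1 1 .leaf .leaf) (.split 3 1 1 1 .leaf .leaf)) .leaf) .leaf))) (.split 2 0 1 1 (.split 3
    0 1 1 (.split 1 0 1 1 (.split 1 2 1 1 (.split 3 2 1 1 .leaf .leaf) .leaf) (.split 1 2 1 1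
    (.split 0 2 1 1 (.split 3 2 1 1 (.split 1 3 1 1 .leaf .leaf) (.split 3 1 1 1 (.split 1 2 1 1
    .leaf .leaf) .leaf)) (.split 3 1 1 1 .leaf .leaf)) .leaf)) (.split 1 2 1 1 (.split 3 2 1 1
    (.split 0 2 1 1 (.split 1 0 1 1 .leaf .leaf) (.split 0 1 1 1 (.split 1 2 1 1 .leaf .leaf)
    .leaf)) (.split 3 1 2 1 .leaf (.split 3 2 1 1 .leaf .leaf))) (.split 3 2 1 1 .leaf (.split 1
    0 1 1 (.split 3 2 1 1 .leaf .leaf) (.split 3 2 1 1 .leaf .leaf))))) (.split 1 0 1 1 (.split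
    3 0 1 1 .leaf (.split 3 2 1 1 .leaf (.split 3 1 2 1 .leaf (.split 3 0 1 1 .leaf .leaf))))
    (.split 3 2 1 1 (.split 1 2 1 1 .leaf .leaf) (.split 3 0 1 1 .leaf (.split 2 1 1 1 (.split 3
    0 1 1 .leaf .leaf) (.split 3 0 1 1 .leaf .leaf))))))

theorem treeCheck_chamber : treeCheck chamberTree chamber = true := by
  decide +kernel

theorem le_tops_one {ι : Type*} (f : ι → ℕ) {l : List ι} {a : ι} (ha : a ∈ l) :
    f a ≤ (tops f l).1 := by
  induction l with
  | nil => simp at ha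
  | cons x l ih => grind [tops]

theorem add_le_tops_two {ι : Type*} (f : ι → ℕ) {l : List ι} {a b : ι} (ha : a ∈ l) (hb : b ∈ l)
    (hab : a ≠ b) : f a + f b ≤ (tops f l).2.1 := by
  induction l with
  | nil => simp at ha
  | cons x l ih =>
    have h := fun c (hc : c ∈ l) => le_tops_one f hc
    grind [tops]

theorem add_add_le_tops_three {ι : Type*} (f : ι → ℕ) {l : List ι} {a b c : ι} (ha : a ∈ l)
    (hb : b ∈ l) (hc : c ∈ l) (hab : a ≠ b) (hac : a ≠ c) (hbc : b ≠ c) :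
    f a + f b + f c ≤ (tops f l).2.2 := by
  induction l with
  | nil => simp at ha
  | cons x l ih =>
    have h := fun c d (hc : c ∈ l) (hd : d ∈ l) (hcd : c ≠ d) => add_le_tops_two f hc hd hcd
    grind [tops]

theorem add_add_le_tripleBound {ι : Type*} (f : ι → ℕ) {l₁ l₂ l₃ : List ι} (h₁₂ : l₂ ⊆ l₁)
    (h₂₃ : l₃ ⊆ l₂) {a b c : ι} (ha : a ∈ l₁) (hb : b ∈ l₂) (hc : c ∈ l₃) (hab : a ≠ b)
    (hac : a ≠ c) (hbc : b ≠ c) : f a + f b + f c ≤ tripleBound f l₁ l₂ l₃ := by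
  have e₁ := le_tops_one f ha
  have e₂ := le_tops_one f hb
  have e₃ := le_tops_one f hc
  have e₄ := add_le_tops_two f hb (h₂₃ hc) hbc
  have e₅ := add_le_tops_two f ha (h₁₂ hb) hab
  have e₆ := add_add_le_tops_three f ha (h₁₂ hb) (h₁₂ (h₂₃ hc)) hab hac hbc
  simp only [tripleBound, le_min_iff]
  omega

/-- A triple with no entry outside `l₁`, at most one outside `l₂` and at most two outside `l₃`
obeys `tripleBound`. -/
theorem sum_le_tripleBound {ι : Type*} (f : ι → ℕ) {l₁ l₂ l₃ : List ι} (h₁₂ : l₂ ⊆ l₁)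
    (h₂₃ : l₃ ⊆ l₂) {b : Fin 3 → ι} (hb : Function.Injective b) (h₁ : ∀ i, b i ∈ l₁)
    (h₂ : ∀ i j, i ≠ j → b i ∈ l₂ ∨ b j ∈ l₂) (h₃ : ∃ i, b i ∈ l₃) :
    f (b 0) + f (b 1) + f (b 2) ≤ tripleBound f l₁ l₂ l₃ := by
  have key : ∀ i j k : Fin 3, i ≠ j → i ≠ k → j ≠ k → b k ∈ l₃ →
      f (b i) + f (b j) + f (b k) ≤ tripleBound f l₁ l₂ l₃ := by
    intro i j k hij hik hjk hk
    rcases h₂ i j hij with h | h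
    · have := add_add_le_tripleBound f h₁₂ h₂₃ (h₁ j) h hk (hb.ne hij.symm) (hb.ne hjk)
        (hb.ne hik)
      omega
    · exact add_add_le_tripleBound f h₁₂ h₂₃ (h₁ i) h hk (hb.ne hij) (hb.ne hik) (hb.ne hjk)
  obtain ⟨k, hk⟩ := h₃
  fin_cases k
  · have := key 1 2 0 (by decide) (by decide) (by decide) hk
    omega
  · have := key 0 2 1 (by decide) (by decide) (by decide) hk
    omega
  · exact key 0 1 2 (by decide) (by decide) (by decide) hk

theorem allTails_append {ι : Type*} {f : ι → List ι → Bool} {x : ι} {s : List ι} :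
    ∀ l : List ι, allTails f (l ++ x :: s) = true → f x s = true
  | [], h => by simp_all [allTails]
  | a :: l, h => by
    simp only [List.cons_append, allTails, Bool.and_eq_true] at h
    exact allTails_append l h.2

/-- `u` lies in the cone generated by the vectors `C k`. -/
def InCone (C : Fin 4 → Fin 5 → ℕ) (u : Fin 5 → ℚ) : Prop :=
  ∃ c : Fin 4 → ℚ, (∀ k, 0 ≤ c k) ∧ ∀ t, u t = ∑ k, c k * C k t

theorem InCone.update {C : Fin 4 → Fin 5 → ℕ} {u : Fin 5 → ℚ} {c : Fin 4 → ℚ}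
    (hc : ∀ k, 0 ≤ c k) (hu : ∀ t, u t = ∑ k, c k * C k t) {i j : Fin 4} (hij : i ≠ j) {p q : ℕ}
    (hp : 0 < p) (h : c i * q ≤ c j * p) {w : Fin 5 → ℕ} (hw : ∀ t, w t = p * C i t + q * C j t) :
    InCone (Function.update C i w) u := by
  have hp' : (0 : ℚ) < p := by exact_mod_cast hp
  refine ⟨Function.update (Function.update c i (c i / p)) j (c j - q * (c i / p)), fun k => ?_,
    fun t => ?_⟩
  · rcases eq_or_ne k j with rfl | hkj
    · rw [Function.update_self, sub_nonneg, mul_div_assoc', div_le_iff₀ hp']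
      linarith
    · rw [Function.update_of_ne hkj]
      rcases eq_or_ne k i with rfl | hki
      · rw [Function.update_self]
        exact div_nonneg (hc k) hp'.le
      · rw [Function.update_of_ne hki]
        exact hc k
  · rw [hu t, ← sub_eq_zero, ← Finset.sum_sub_distrib,
      Fintype.sum_eq_add i j hij (fun k hk => by
        simp [Function.update_of_ne hk.1, Function.update_of_ne hk.2])]
    simp only [Function.update_self, Function.update_of_ne hij, Function.update_of_ne hij.symm, hw]
    push_cast
    field_simp
    ring

theorem InCone.split {C : Fin 4 → Fin 5 → ℕ} {u : Fin 5 → ℚ} (hu : InCone C u) {i j : Fin 4}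
    (hij : i ≠ j) {p q : ℕ} (hp : 0 < p) (hq : 0 < q) :
    InCone (Function.update C i fun t => p * C i t + q * C j t) u ∨
      InCone (Function.update C j fun t => p * C i t + q * C j t) u := by
  obtain ⟨c, hc, hu⟩ := hu
  rcases le_total (c i * q) (c j * p) with h | h
  · exact .inl (InCone.update hc hu hij hp h fun t => rfl)
  · exact .inr (InCone.update hc hu hij.symm hq h fun t => add_comm _ _)

theorem InCone.le_of_nonnegOn {C : Fin 4 → Fin 5 → ℕ} {u : Fin 5 → ℚ} (hu : InCone C u)
    {x y z : Fin 5 × Fin 5} (h : nonnegOn C x y z = true) :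
    6 * ∑ t, u t ≤ 5 * ((u x.1 + u x.2) + (u y.1 + u y.2) + (u z.1 + u z.2)) := by
  obtain ⟨c, hc, hu⟩ := hu
  have h' : ∀ k, c k * (6 * ∑ t, (C k t : ℚ)) ≤ c k * (5 * ((C k x.1 + C k x.2) +
      (C k y.1 + C k y.2) + (C k z.1 + C k z.2))) := by
    intro k
    refine mul_le_mul_of_nonneg_left ?_ (hc k)
    simp only [nonnegOn, List.all_eq_true, List.mem_finRange, forall_const, Nat.ble_eq, total,
      pairWt] at h
    rw [Fin.sum_univ_five]
    exact_mod_cast h k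
  have := Finset.sum_le_sum fun k (_ : k ∈ Finset.univ) => h' k
  simp only [hu, Fin.sum_univ_five, Fin.sum_univ_four] at this ⊢
  linarith

theorem exists_order_of_treeCheck (T : ConeTree) {C : Fin 4 → Fin 5 → ℕ}
    (h : treeCheck T C = true) {u : Fin 5 → ℚ} (hu : InCone C u) :
    ∃ o : List (Fin 5 × Fin 5), o.Perm quadPairs ∧ ∀ A x B y D z E,
      o = A ++ x :: (B ++ y :: (D ++ z :: E)) →
      6 * ∑ t, u t ≤ 5 * ((u x.1 + u x.2) + (u y.1 + u y.2) + (u z.1 + u z.2)) ∨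
      ∃ k, 5 * tripleBound (pairWt (shiftedRho k)) (x :: (B ++ y :: (D ++ z :: E)))
        (y :: (D ++ z :: E)) (z :: E) < 6 * total (shiftedRho k) := by
  induction T generalizing C with
  | leaf =>
    refine ⟨coneOrder C, List.perm_insertionSort _ _, fun A x B y D z E ho => ?_⟩
    rw [treeCheck, leafCheck, ho] at h
    have h := allTails_append _ (allTails_append _ (allTails_append _ h))
    rw [Bool.or_eq_true] at h
    refine h.imp hu.le_of_nonnegOn fun h => ?_
    simpa [excluded] using h
  | split i j p q l r ihl ihr =>
    simp only [treeCheck, Bool.and_eq_true, decide_eq_true_eq, Nat.blt_eq] at h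
    rcases hu.split h.1.1.1 h.1.1.2 h.1.2 with hu | hu
    · exact ihl h.2.1 hu
    · exact ihr h.2.2 hu

theorem inCone_chamber {u : Fin 5 → ℚ} (hu : Antitone u) (h4 : u 4 = 0) : InCone chamber u := by
  have h := fun (i j : Fin 5) (hij : i ≤ j) => sub_nonneg.2 (hu hij)
  refine ⟨![u 3 - u 4, u 2 - u 3, u 1 - u 2, u 0 - u 1], fun k => ?_, fun t => ?_⟩
  · fin_cases k <;> exact h _ _ (by decide)
  · fin_cases t <;> simp [Fin.sum_univ_four, chamber, h4]

section LinearAlgebra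

variable {K V ι : Type*} [Field K] [AddCommGroup V] [Module K V]

theorem _root_.LinearIndependent.card_le_finrank_of_forall_mem [FiniteDimensional K V]
    {κ : Type*} [Fintype κ] {b : κ → V} (hb : LinearIndependent K b) {W : Submodule K V}
    (h : ∀ i, b i ∈ W) : Fintype.card κ ≤ Module.finrank K W := by
  rw [← finrank_span_eq_card hb]
  exact Submodule.finrank_mono (Submodule.span_le.2 (Set.range_subset_iff.2 h))

theorem exists_append_cons_of_notMem (v : ι → V) (W : Submodule K V) {l : List ι}
    (h : ∃ x ∈ l, v x ∉ W) :
    ∃ A x B, l = A ++ x :: B ∧ v x ∉ W ∧ ∀ a ∈ A, v a ∈ W := by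
  induction l with
  | nil => simp at h
  | cons a l ih =>
    by_cases ha : v a ∈ W
    · obtain ⟨A, x, B, rfl, hx, hA⟩ := ih (by simpa [ha] using h)
      exact ⟨a :: A, x, B, rfl, hx, by simpa [ha] using hA⟩
    · exact ⟨[], a, l, rfl, ha, by simp⟩

/-- The greedy basis among the vectors `v x`, with `x` running through an ordered list, dominates
every other basis. -/
theorem exists_greedy_triple [FiniteDimensional K V] (v : ι → V) {o : List ι}
    (ho : ∀ W : Submodule K V, Module.finrank K W < 3 → ∃ x ∈ o, v x ∉ W) :
    ∃ A x B y D z E, o = A ++ x :: (B ++ y :: (D ++ z :: E)) ∧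
      LinearIndependent K ![v z, v y, v x] ∧
      ∀ (f : ι → ℕ) (b : Fin 3 → ι), (∀ i, b i ∈ o) → LinearIndependent K (v ∘ b) →
        f (b 0) + f (b 1) + f (b 2) ≤ tripleBound f (x :: (B ++ y :: (D ++ z :: E)))
          (y :: (D ++ z :: E)) (z :: E) := by
  have hr₁ : ∀ x, Module.finrank K (Submodule.span K {v x}) ≤ 1 := fun x => by
    simpa using finrank_span_le_card (R := K) ({v x} : Set V)
  have hr₂ : ∀ x y, Module.finrank K (Submodule.span K {v y, v x}) ≤ 2 := fun x y => by
    classical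
    refine (finrank_span_le_card (R := K) ({v y, v x} : Set V)).trans ?_
    simpa using Finset.card_le_two
  obtain ⟨A, x, s, rfl, hx, hA⟩ := exists_append_cons_of_notMem v ⊥ (ho ⊥ (by simp))
  have hA₀ : ∀ (W : Submodule K V), ∀ a ∈ A, v a ∈ W := fun W a ha => by
    rw [(Submodule.mem_bot K).1 (hA a ha)]
    exact W.zero_mem
  have hxW : v x ∈ Submodule.span K {v x} := Submodule.mem_span_singleton_self _
  obtain ⟨B, y, t, rfl, hy, hB⟩ := exists_append_cons_of_notMem v (Submodule.span K {v x})
    (l := s) (by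
      obtain ⟨a, ha, haW⟩ := ho (Submodule.span K {v x}) ((hr₁ x).trans_lt (by norm_num))
      grind)
  have hle : Submodule.span K {v x} ≤ Submodule.span K {v y, v x} :=
    Submodule.span_mono (by simp)
  have hyW : v y ∈ Submodule.span K {v y, v x} := Submodule.subset_span (by simp)
  obtain ⟨D, z, E, rfl, hz, hD⟩ := exists_append_cons_of_notMem v (Submodule.span K {v y, v x})
    (l := t) (by
      obtain ⟨a, ha, haW⟩ := ho (Submodule.span K {v y, v x}) ((hr₂ x y).trans_lt (by norm_num))
      have := hle hxW
      have := fun a ha => hle (hB a ha)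
      grind)
  refine ⟨A, x, B, y, D, z, E, rfl, ?_, fun f b hbo hb => ?_⟩
  · have hx0 : v x ≠ 0 := by simpa using hx
    refine linearIndependent_finCons.2 ⟨linearIndependent_finCons.2
      ⟨LinearIndependent.of_subsingleton 0 hx0, ?_⟩, ?_⟩
    · simpa using hy
    · simpa [Set.pair_comm] using hz
  · have hS : ∀ i, b i ∈ A ∨ b i = x ∨ b i ∈ B ∨ b i = y ∨ b i ∈ D ∨ b i ∈ z :: E := fun i => by
      have := hbo i
      grind
    refine sum_le_tripleBound f (by grind) (by grind)
      (Function.Injective.of_comp hb.injective) (fun i => ?_) (fun i j hij => ?_) ?_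
    · have h0 : b i ∉ A := fun h => hb.ne_zero i (hA₀ ⊥ _ h)
      have := hS i
      grind
    · by_contra! h
      have hW : ∀ k, b k ∉ y :: (D ++ z :: E) → v (b k) ∈ Submodule.span K {v x} := by
        intro k hk
        have := hS k
        have := hA₀ (Submodule.span K {v x})
        grind
      have := (hb.comp ![i, j] (by
        intro a b
        fin_cases a <;> fin_cases b <;> simp [hij, hij.symm])).card_le_finrank_of_forall_mem
        (W := Submodule.span K {v x}) (by
          intro a
          fin_cases a
          · exact hW i h.1
          · exact hW j h.2)
      have := hr₁ x
      simp at *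
      omega
    · by_contra! h
      have := hb.card_le_finrank_of_forall_mem (W := Submodule.span K {v y, v x}) (by
        intro k
        have := hS k
        have := h k
        have := hA₀ (Submodule.span K {v y, v x})
        have := hle hxW
        have := fun a ha => hle (hB a ha)
        simp only [Function.comp_apply]
        grind)
      have := hr₂ x y
      simp at *
      omega

end LinearAlgebra

/-- The restriction to `Λ` of the functional taking the coefficient at `m`. -/
noncomputable def coeffOn (Λ : Submodule ℂ Quin) (m : Fin 5 →₀ ℕ) : Module.Dual ℂ Λ :=
  (lcoeff ℂ m).comp Λ.subtype

theorem bijective_coeff_iff {Λ : Submodule ℂ Quin} (hΛ : Module.finrank ℂ Λ = 3)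
    (m₁ m₂ m₃ : Fin 5 →₀ ℕ) :
    Function.Bijective (fun Q : Λ =>
      (![coeff m₁ (Q : Quin), coeff m₂ (Q : Quin), coeff m₃ (Q : Quin)] : Fin 3 → ℂ)) ↔
      LinearIndependent ℂ ![coeffOn Λ m₁, coeffOn Λ m₂, coeffOn Λ m₃] := by
  have : FiniteDimensional ℂ Λ := Module.finite_of_finrank_pos (by omega)
  let φ : Λ →ₗ[ℂ] Fin 3 → ℂ := LinearMap.pi ![coeffOn Λ m₁, coeffOn Λ m₂, coeffOn Λ m₃]
  have hφ : (fun Q : Λ =>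
      (![coeff m₁ (Q : Quin), coeff m₂ (Q : Quin), coeff m₃ (Q : Quin)] : Fin 3 → ℂ)) = φ := by
    ext Q i
    fin_cases i <;> rfl
  rw [hφ]
  constructor
  · intro h
    refine Fintype.linearIndependent_iff.2 fun g hg i => ?_
    obtain ⟨Q, hQ⟩ := h.2 (Pi.single i 1)
    have hQ' : ∀ k, (![coeffOn Λ m₁, coeffOn Λ m₂, coeffOn Λ m₃] k) Q =
      (Pi.single i 1 : Fin 3 → ℂ) k := fun k => congrFun hQ k
    have := LinearMap.congr_fun hg Q
    simpa [LinearMap.sum_apply, hQ', Pi.single_apply] using this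
  · intro h
    have hinj : Function.Injective φ := by
      rw [← LinearMap.ker_eq_bot, LinearMap.ker_eq_bot']
      intro Q hQ
      have hspan := h.span_eq_top_of_card_eq_finrank (by
        rw [Subspace.dual_finrank_eq, hΛ, Fintype.card_fin])
      refine (Module.forall_dual_apply_eq_zero_iff ℂ Q).1 fun ψ => ?_
      have hψ : ψ ∈ Submodule.span ℂ (Set.range ![coeffOn Λ m₁, coeffOn Λ m₂, coeffOn Λ m₃]) :=
        hspan ▸ Submodule.mem_top
      induction hψ using Submodule.span_induction with
      | mem ψ h =>
        obtain ⟨k, rfl⟩ := h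
        exact congrFun hQ k
      | zero => rfl
      | add _ _ _ _ h₁ h₂ => rw [LinearMap.add_apply, h₁, h₂, add_zero]
      | smul c _ _ h => rw [LinearMap.smul_apply, h, smul_zero]
    exact ⟨hinj, (LinearMap.injective_iff_surjective_of_finrank_eq_finrank (by simp [hΛ])).1 hinj⟩

/-- The monomial with code `x`, in the variables permuted by `σ`. -/
noncomputable def pairMon (σ : Equiv.Perm (Fin 5)) (x : Fin 5 × Fin 5) : Fin 5 →₀ ℕ :=
  Finsupp.single (σ x.1) 1 + Finsupp.single (σ x.2) 1

theorem quadMon_pairMon (σ : Equiv.Perm (Fin 5)) (x : Fin 5 × Fin 5) :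
    QuadMon (pairMon σ x) := by
  rw [QuadMon, pairMon, Finsupp.sum_add_index' (fun _ => rfl) (fun _ _ _ => rfl)]
  simp

theorem exists_pairMon_eq (σ : Equiv.Perm (Fin 5)) {m : Fin 5 →₀ ℕ} (hm : QuadMon m) :
    ∃ x ∈ quadPairs, pairMon σ x = m := by
  obtain ⟨a, b, hab⟩ := Multiset.card_eq_two.1 ((Finsupp.card_toMultiset m).trans hm)
  have hm' : m = Finsupp.single a 1 + Finsupp.single b 1 := by
    apply Multiset.toFinsupp.symm.injective
    change Finsupp.toMultiset m = Finsupp.toMultiset _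
    rw [hab, map_add, Finsupp.toMultiset_single, Finsupp.toMultiset_single, one_smul, one_smul]
    rfl
  have hmem : ∀ i j : Fin 5, i ≤ j → (i, j) ∈ quadPairs := by decide
  rcases le_total (σ.symm a) (σ.symm b) with h | h
  · exact ⟨_, hmem _ _ h, by simp [pairMon, hm']⟩
  · exact ⟨_, hmem _ _ h, by simp [pairMon, hm', add_comm]⟩

theorem wt_pairMon (ρ : Fin 5 → ℤ) (σ : Equiv.Perm (Fin 5)) (x : Fin 5 × Fin 5) :
    wt ρ (pairMon σ x) = ρ (σ x.1) + ρ (σ x.2) := by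
  simp [wt, pairMon, add_mul, Finset.sum_add_distrib, Finsupp.single_apply]

theorem exists_coeffOn_notMem {Λ : Submodule ℂ Quin} (hΛ : IsNet Λ) (σ : Equiv.Perm (Fin 5))
    (W : Submodule ℂ (Module.Dual ℂ Λ)) (hW : Module.finrank ℂ W < 3) :
    ∃ x ∈ quadPairs, coeffOn Λ (pairMon σ x) ∉ W := by
  have : FiniteDimensional ℂ Λ := Module.finite_of_finrank_pos (by have := hΛ.1; omega)
  by_contra! h
  have hne : W.dualCoannihilator ≠ ⊥ := by
    intro hbot
    have := Subspace.finrank_add_finrank_dualCoannihilator_eq W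
    rw [hbot, finrank_bot, hΛ.1] at this
    omega
  obtain ⟨Q, hQ, hQ0⟩ := Submodule.exists_mem_ne_zero_of_ne_bot hne
  refine hQ0 (Subtype.ext (MvPolynomial.ext _ _ fun m => ?_))
  by_cases hm : QuadMon m
  · obtain ⟨x, hx, rfl⟩ := exists_pairMon_eq σ hm
    exact (Submodule.mem_dualCoannihilator Q).1 hQ _ (h x hx)
  · exact (hΛ.2 Q Q.2).coeff_eq_zero hm

theorem shiftedRho_cast (k : Fin 12) (i : Fin 5) : (shiftedRho k i : ℤ) = rho k i - rho k 4 := by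
  revert k i
  decide

theorem sum_rho (k : Fin 12) : ∑ i, rho k i = 0 := by
  revert k
  decide

theorem six_mul_total_shiftedRho_le (k : Fin 12) (x y z : Fin 5 × Fin 5)
    (h : 0 ≤ (rho k x.1 + rho k x.2) + (rho k y.1 + rho k y.2) + (rho k z.1 + rho k z.2)) :
    6 * total (shiftedRho k) ≤ 5 * (pairWt (shiftedRho k) x + pairWt (shiftedRho k) y +
      pairWt (shiftedRho k) z) := by
  have hs := sum_rho k
  rw [Fin.sum_univ_five] at hs
  zify [total, pairWt]
  simp only [shiftedRho_cast]
  linarith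

theorem semistableWrt_of_twelve {Λ : Submodule ℂ Quin} (hΛ : IsNet Λ)
    (h : ∀ (k : Fin 12) (σ : Equiv.Perm (Fin 5)), SemistableWrt Λ (rho k ∘ σ)) {ρ : Fin 5 → ℤ}
    (hρ : ∑ i, ρ i = 0) : SemistableWrt Λ ρ := by
  have : FiniteDimensional ℂ Λ := Module.finite_of_finrank_pos (by have := hΛ.1; omega)
  obtain ⟨σ, hσ⟩ : ∃ σ : Equiv.Perm (Fin 5), Antitone (ρ ∘ σ) :=
    ⟨Tuple.sort (-ρ), fun i j hij => by simpa using Tuple.monotone_sort (-ρ) hij⟩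
  obtain ⟨o, hperm, ho⟩ := exists_order_of_treeCheck chamberTree treeCheck_chamber
    (u := fun i => ((ρ (σ i) - ρ (σ 4) : ℤ) : ℚ)) (inCone_chamber (fun i j hij => by
      have := hσ hij
      simp only [Function.comp_apply] at this
      exact_mod_cast sub_le_sub_right this _) (by simp))
  obtain ⟨A, x, B, y, D, z, E, rfl, hli, hdom⟩ :=
    exists_greedy_triple (fun p => coeffOn Λ (pairMon σ p)) (o := o) fun W hW => by
      simpa only [hperm.mem_iff] using exists_coeffOn_notMem hΛ σ W hW
  have hinj := hli.injective
  refine ⟨pairMon σ z, pairMon σ y, pairMon σ x, fun e => ?_, fun e => ?_, fun e => ?_,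
    quadMon_pairMon _ _, quadMon_pairMon _ _, quadMon_pairMon _ _, ?_,
    (bijective_coeff_iff hΛ.1 _ _ _).2 hli⟩
  · exact absurd (@hinj 0 1 (by simp [e])) (by decide)
  · exact absurd (@hinj 0 2 (by simp [e])) (by decide)
  · exact absurd (@hinj 1 2 (by simp [e])) (by decide)
  rcases ho A x B y D z E rfl with hpos | ⟨k, hk⟩
  · have hsum : ∑ i, ρ (σ i) = 0 := (Equiv.sum_comp σ ρ).trans hρ
    rw [Fin.sum_univ_five] at hsum hpos
    simp only [wt_pairMon]
    norm_cast at hpos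
    linarith
  · exfalso
    obtain ⟨m₁, m₂, m₃, -, -, -, q₁, q₂, q₃, hwt, hbij⟩ := h k σ.symm
    obtain ⟨b₁, hb₁, rfl⟩ := exists_pairMon_eq σ q₁
    obtain ⟨b₂, hb₂, rfl⟩ := exists_pairMon_eq σ q₂
    obtain ⟨b₃, hb₃, rfl⟩ := exists_pairMon_eq σ q₃
    have hle := hdom (pairWt (shiftedRho k)) ![b₁, b₂, b₃]
      (fun i => hperm.mem_iff.2 (by fin_cases i <;> assumption)) (by
        have e : (fun p => coeffOn Λ (pairMon σ p)) ∘ ![b₁, b₂, b₃] =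
            ![coeffOn Λ (pairMon σ b₁), coeffOn Λ (pairMon σ b₂), coeffOn Λ (pairMon σ b₃)] := by
          funext i
          fin_cases i <;> rfl
        rw [e]
        exact (bijective_coeff_iff hΛ.1 _ _ _).1 hbij)
    simp only [wt_pairMon, Function.comp_apply, Equiv.symm_apply_apply] at hwt
    have := six_mul_total_shiftedRho_le k b₁ b₂ b₃ hwt
    simp only [Matrix.cons_val] at hle
    omega

end NetOfQuadrics

/-- A net of quadrics is semistable with respect to every integer weight
vector summing to zero if and only if it is semistable with respect to every permutation
of the twelve distinguished weight vectors `ρ1,…,ρ12`. -/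
theorem netSemistable_iff_twelve (Λ : Submodule ℂ Quin) (hΛ : IsNet Λ) :
    (∀ ρ : Fin 5 → ℤ, (∑ i, ρ i) = 0 → SemistableWrt Λ ρ) ↔
    (∀ (k : Fin 12) (σ : Equiv.Perm (Fin 5)), SemistableWrt Λ (rho k ∘ σ)) :=
  ⟨fun h k σ => h _ ((Equiv.sum_comp σ (rho k)).trans (NetOfQuadrics.sum_rho k)),
    fun h _ hρ => NetOfQuadrics.semistableWrt_of_twelve hΛ h hρ⟩
end

section
/- Let Λ be a net of quadrics in the variables a,b,c,d,e which is ρ-semistable for every weight vector ρ obtained by permuting the entries of one of the twelve vectors ρ1,…,ρ12. Let χ=(w_a,w_b,w_c,w_d,w_e) be a normalized integer weight vector with w_b ≤ 0. Then Λ is χ-semistable. -/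
open MvPolynomial

/-- Basis exchange for jointly bijective families of linear functionals: the `i₀`-th member can be
replaced by some member of any family of functionals that separates `0`. -/
theorem exists_bijective_update {K V ι κ : Type*} [Field K] [AddCommGroup V] [Module K V]
    [DecidableEq ι] (f : ι → Module.Dual K V) (g : κ → Module.Dual K V)
    (hf : Function.Bijective fun v i => f i v) (hg : ∀ v, (∀ j, g j v = 0) → v = 0) (i₀ : ι) :
    ∃ j, Function.Bijective fun v i => Function.update f i₀ (g j) i v := by
  obtain ⟨v, hv⟩ := hf.2 (Pi.single i₀ 1)
  have hv₀ : f i₀ v = 1 := by simpa using congrFun hv i₀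
  have hv₁ : ∀ i, i ≠ i₀ → f i v = 0 := fun i hi => by simpa [hi] using congrFun hv i
  have hne : v ≠ 0 := by
    rintro rfl
    simp at hv₀
  obtain ⟨j, hj⟩ : ∃ j, g j v ≠ 0 := by
    by_contra! h
    exact hne (hg v h)
  refine ⟨j, fun x y hxy => ?_, fun y => ?_⟩
  · have h₁ : ∀ i, i ≠ i₀ → f i x = f i y := fun i hi => by
      simpa [Function.update_of_ne hi] using congrFun hxy i
    have h₀ : g j x = g j y := by simpa using congrFun hxy i₀
    have hxyv : x = y + (f i₀ x - f i₀ y) • v := by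
      apply hf.1
      funext i
      by_cases hi : i = i₀
      · subst hi
        simp [hv₀]
      · simp [hv₁ i hi, h₁ i hi]
    have hzero : (f i₀ x - f i₀ y) * g j v = 0 := by
      have := congrArg (g j) hxyv
      simp only [map_add, map_smul, smul_eq_mul, h₀] at this
      simpa using this
    rw [hxyv, (mul_eq_zero.mp hzero).resolve_right hj, zero_smul, add_zero]
  · obtain ⟨u, hu⟩ := hf.2 y
    refine ⟨u + ((y i₀ - g j u) / g j v) • v, ?_⟩
    funext i
    by_cases hi : i = i₀
    · subst hi
      simp [hj]
    · simpa [Function.update_of_ne hi, hv₁ i hi] using congrFun hu i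

/-- The coefficient functional of a monomial, restricted to a subspace. -/
noncomputable def coeffDual (Λ : Submodule ℂ Quin) (m : Fin 5 →₀ ℕ) : Module.Dual ℂ Λ :=
  (MvPolynomial.lcoeff ℂ m).comp Λ.subtype

theorem injective_of_surjective_coeffDual {ι : Type*} {Λ : Submodule ℂ Quin}
    {m : ι → Fin 5 →₀ ℕ} (h : Function.Surjective fun Q i => coeffDual Λ (m i) Q) :
    Function.Injective m := by
  classical
  intro i j hij
  by_contra hne
  obtain ⟨Q, hQ⟩ := h (Pi.single i 1)
  have hi := congrFun hQ i
  have hj := congrFun hQ j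
  simp only [Pi.single_eq_same, Pi.single_eq_of_ne (Ne.symm hne), hij] at hi hj
  exact one_ne_zero (hi.symm.trans hj)

theorem semistableWrt_iff {Λ : Submodule ℂ Quin} {ρ : Fin 5 → ℤ} :
    SemistableWrt Λ ρ ↔ ∃ m : Fin 3 → Fin 5 →₀ ℕ, (∀ i, QuadMon (m i)) ∧
      0 ≤ ∑ i, wt ρ (m i) ∧ Function.Bijective fun Q i => coeffDual Λ (m i) Q := by
  constructor
  · rintro ⟨m1, m2, m3, -, -, -, h1, h2, h3, hw, hb⟩
    refine ⟨![m1, m2, m3], by simp [Fin.forall_fin_succ, h1, h2, h3],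
      by simpa [Fin.sum_univ_three] using hw, ?_⟩
    convert hb using 2 with Q
    funext i
    fin_cases i <;> rfl
  · rintro ⟨m, hq, hw, hb⟩
    have hm := injective_of_surjective_coeffDual hb.2
    refine ⟨m 0, m 1, m 2, hm.ne (by decide), hm.ne (by decide), hm.ne (by decide),
      hq 0, hq 1, hq 2, by simpa [Fin.sum_univ_three] using hw, ?_⟩
    convert hb using 2 with Q
    funext i
    fin_cases i <;> rfl

theorem QuadMon.sum_eq {m : Fin 5 →₀ ℕ} (h : QuadMon m) : m 0 + m 1 + m 2 + m 3 + m 4 = 2 := by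
  rw [QuadMon, Finsupp.sum_fintype _ _ fun _ => rfl] at h
  simpa [Fin.sum_univ_five] using h

/-- Three distinct quadratic monomials, none equal to `e²`, of total degree at least `2` in `a`
have nonnegative total weight for every normalized weight vector with `w_b ≤ 0`. -/
theorem sum_wt_nonneg {χ : Fin 5 → ℤ} (hχ : IsNormalized χ) (hb : χ 1 ≤ 0)
    {m : Fin 3 → Fin 5 →₀ ℕ} (hm : Function.Injective m) (hq : ∀ i, QuadMon (m i))
    (ha : 2 ≤ ∑ i, m i 0) (he : ∀ i, m i 4 ≤ 1) : 0 ≤ ∑ i, wt χ (m i) := by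
  obtain ⟨hmono, hsum, -⟩ := hχ
  simp only [Fin.sum_univ_five] at hsum
  have h01 := hmono 0 1 (by decide)
  have h12 := hmono 1 2 (by decide)
  have h23 := hmono 2 3 (by decide)
  have h34 := hmono 3 4 (by decide)
  have hdeg := fun i => (hq i).sum_eq
  have hae : ∀ i j, i ≠ j → ¬(m i 0 = 1 ∧ m i 4 = 1 ∧ m j 0 = 1 ∧ m j 4 = 1) := by
    rintro i j hij ⟨h1, h2, h3, h4⟩
    refine hij (hm (Finsupp.ext fun k => ?_))
    have hi := hdeg i
    have hj := hdeg j
    fin_cases k <;> simp only [Fin.zero_eta, Fin.mk_one, Fin.reduceFinMk] <;> omega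
  have hsum3 : ∀ k : Fin 5, ∑ i, m i k = m 0 k + m 1 k + m 2 k := fun k => Fin.sum_univ_three _
  have he2 : ∑ i, m i 4 ≤ 2 := by
    have := hae 0 1 (by decide)
    have := hae 0 2 (by decide)
    have := hae 1 2 (by decide)
    have := hdeg 0
    have := hdeg 1
    have := hdeg 2
    have := he 0
    have := he 1
    have := he 2
    rw [hsum3] at ha ⊢
    omega
  have htot : ∑ i, m i 3 + (∑ i, m i 0 + ∑ i, m i 1 + ∑ i, m i 2 + ∑ i, m i 4) = 6 := by
    have := hdeg 0
    have := hdeg 1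
    have := hdeg 2
    simp only [hsum3]
    omega
  have hwt : ∑ i, wt χ (m i) = (∑ i, m i 0 : ℕ) * χ 0 + (∑ i, m i 1 : ℕ) * χ 1
      + (∑ i, m i 2 : ℕ) * χ 2 + (∑ i, m i 3 : ℕ) * χ 3 + (∑ i, m i 4 : ℕ) * χ 4 := by
    simp only [wt, Fin.sum_univ_five, Fin.sum_univ_three]
    push_cast
    ring
  rw [hwt]
  generalize ∑ i, m i 0 = A at *
  generalize ∑ i, m i 1 = B at *
  generalize ∑ i, m i 2 = C at *
  generalize ∑ i, m i 3 = D at *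
  generalize ∑ i, m i 4 = E at *
  have hD : (D : ℤ) = 6 - (A + B + C + E) := by omega
  rw [hD]
  have hA' : (2 : ℤ) ≤ A := by exact_mod_cast ha
  have hE' : (E : ℤ) ≤ 2 := by exact_mod_cast he2
  have t1 : 0 ≤ ((A : ℤ) - 2) * (χ 0 - χ 3) := mul_nonneg (by linarith) (by linarith)
  have t2 : 0 ≤ (B : ℤ) * (χ 1 - χ 3) := mul_nonneg (by positivity) (by linarith)
  have t3 : 0 ≤ (C : ℤ) * (χ 2 - χ 3) := mul_nonneg (by positivity) (by linarith)
  have t4 : 0 ≤ (2 - (E : ℤ)) * (χ 3 - χ 4) := mul_nonneg (by linarith) (by linarith)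
  nlinarith

/-- If a net is semistable with respect to all permutations of the twelve
distinguished weight vectors, and `χ` is a normalized weight vector with `χ_b ≤ 0`, then the
net is `χ`-semistable. -/
theorem semistable_of_weight_b_nonpos (Λ : Submodule ℂ Quin) (hΛ : IsNet Λ)
    (h12 : ∀ (k : Fin 12) (σ : Equiv.Perm (Fin 5)), SemistableWrt Λ (rho k ∘ σ))
    (χ : Fin 5 → ℤ) (hχ : IsNormalized χ) (hb : χ 1 ≤ 0) :
    SemistableWrt Λ χ := by
  obtain ⟨n, hnq, hnw, hnb⟩ := semistableWrt_iff.mp (h12 0 1)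
  obtain ⟨m, hmq, hmw, hmb⟩ := semistableWrt_iff.mp (h12 3 1)
  have hn : ∀ i, n i 4 ≤ 1 := by
    have := (hnq 0).sum_eq
    have := (hnq 1).sum_eq
    have := (hnq 2).sum_eq
    simp only [wt, rho, Fin.sum_univ_three, Fin.sum_univ_five] at hnw
    simp at hnw
    intro i
    fin_cases i <;> simp only [Fin.zero_eta, Fin.mk_one, Fin.reduceFinMk] <;> omega
  have hm : 2 ≤ ∑ i, m i 0 := by
    have := (hmq 0).sum_eq
    have := (hmq 1).sum_eq
    have := (hmq 2).sum_eq
    simp only [wt, rho, Fin.sum_univ_three, Fin.sum_univ_five] at hmw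
    simp at hmw
    rw [Fin.sum_univ_three]
    omega
  by_cases he : ∀ i, m i 4 ≤ 1
  · exact semistableWrt_iff.mpr ⟨m, hmq,
      sum_wt_nonneg hχ hb (injective_of_surjective_coeffDual hmb.2) hmq hm he, hmb⟩
  push Not at he
  obtain ⟨i₀, hi₀⟩ := he
  have he_unique : ∀ i, i ≠ i₀ → m i 4 ≤ 1 := by
    intro i hi
    by_contra! h
    refine hi (injective_of_surjective_coeffDual hmb.2 (Finsupp.ext fun k => ?_))
    have h1 := (hmq i).sum_eq
    have h2 := (hmq i₀).sum_eq
    fin_cases k <;> simp only [Fin.zero_eta, Fin.mk_one, Fin.reduceFinMk] <;> omega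
  obtain ⟨j, hj⟩ := exists_bijective_update (fun i => coeffDual Λ (m i))
    (fun i => coeffDual Λ (n i)) hmb
    (fun v hv => hnb.1 (funext fun i => by simpa using hv i)) i₀
  have hj' : Function.Bijective fun Q i => coeffDual Λ (Function.update m i₀ (n j) i) Q := by
    convert hj using 4 with Q i
    by_cases hi : i = i₀
    · subst hi
      simp
    · simp [Function.update_of_ne hi]
  have hq : ∀ i, QuadMon (Function.update m i₀ (n j) i) := by
    intro i
    by_cases hi : i = i₀
    · subst hi
      simpa using hnq j
    · simpa [Function.update_of_ne hi] using hmq i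
  refine semistableWrt_iff.mpr ⟨_, hq, sum_wt_nonneg hχ hb
    (injective_of_surjective_coeffDual hj'.2) hq (hm.trans (Finset.sum_le_sum fun i _ => ?_))
    fun i => ?_, hj'⟩ <;> by_cases hi : i = i₀
  · subst hi
    have := (hmq i).sum_eq
    omega
  · rw [Function.update_of_ne hi]
  · subst hi
    simpa using hn j
  · simpa [Function.update_of_ne hi] using he_unique i hi
end
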